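/- arXiv:2407.11331 — 2 statements merged into one kernel-verified Lean document; each statement's English description precedes it below -/
import Mathlib

section
/- Let k ≥ 2, let n ≥ k + 3, and let B ∈ 𝒰^n. Suppose there are exactly k indices j ∈ {1,…,n} with 𝟙 − e_j ∉ B (so 𝟙 − e_j ∈ B for the remaining n − k indices). Then there exists a set D of nonzero directions with D = −D that illuminates B and satisfies |D| ≤ 2^n − 6 if k = 2, and |D| ≤ 2^n − 2^k − 4 if k ≥ 3. In particular 𝕀(B) ≤ 2^n − 6 when k = 2, and 𝕀(B) ≤ 2^n − 2^k − 4 when k ≥ 3. -/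
open Set

/-- A convex body in `ℝ^n`: a compact convex set with nonempty interior. -/
def IsConvexBody {n : ℕ} (K : Set (Fin n → ℝ)) : Prop :=
  Convex ℝ K ∧ IsCompact K ∧ (interior K).Nonempty

/-- `K` is 1-unconditional: closed under sign changes of the coordinates. -/
def Unconditional {n : ℕ} (K : Set (Fin n → ℝ)) : Prop :=
  ∀ x ∈ K, ∀ ε : Fin n → ℝ, (∀ i, ε i = 1 ∨ ε i = -1) → (fun i => ε i * x i) ∈ K

/-- The direction `d` illuminates the (boundary) point `x` of `K`. -/
def Illuminates {n : ℕ} (K : Set (Fin n → ℝ)) (d x : Fin n → ℝ) : Prop :=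
  ∃ ε : ℝ, 0 < ε ∧ x + ε • d ∈ interior K

/-- The set of directions `D` illuminates every boundary point of `K`. -/
def IlluminatesSet {n : ℕ} (K : Set (Fin n → ℝ)) (D : Set (Fin n → ℝ)) : Prop :=
  ∀ x ∈ frontier K, ∃ d ∈ D, Illuminates K d x

/-- The illumination number: smallest cardinality of a set of nonzero directions
illuminating `K`. -/
noncomputable def illumNumber {n : ℕ} (K : Set (Fin n → ℝ)) : ℕ :=
  sInf {m | ∃ D : Finset (Fin n → ℝ), D.card = m ∧ (∀ d ∈ D, d ≠ 0) ∧
    IlluminatesSet K ↑D}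

/-- A parallelepiped: an affine image of the cube `[-1,1]^n`. -/
def IsParallelepiped {n : ℕ} (K : Set (Fin n → ℝ)) : Prop :=
  ∃ T : (Fin n → ℝ) ≃ᵃ[ℝ] (Fin n → ℝ),
    K = T '' (Set.Icc (fun _ => (-1 : ℝ)) (fun _ => 1))

/-- The standard basis vector `e i`. -/
def stdB {n : ℕ} (i : Fin n) : Fin n → ℝ := Pi.single i 1

/-- The class `𝒰^n`: 1-unconditional convex bodies all of whose standard basis
vectors lie on the boundary. -/
def memU {n : ℕ} (K : Set (Fin n → ℝ)) : Prop :=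
  IsConvexBody K ∧ Unconditional K ∧ ∀ i : Fin n, stdB i ∈ frontier K

/-- A 1-unconditional body is cubelike if all its extreme points have all
coordinates nonzero. -/
def Cubelike {n : ℕ} (K : Set (Fin n → ℝ)) : Prop :=
  ∀ x ∈ Set.extremePoints ℝ K, ∀ i, x i ≠ 0

/-- The all-ones vector `𝟙`. -/
def allOnes {n : ℕ} : Fin n → ℝ := fun _ => 1

/-- First order growth of `|x + ε d|`. -/
noncomputable def gr (x d : ℝ) : ℝ := if x = 0 then |d| else if 0 < x then d else -d

lemma gr_le (x d : ℝ) : gr x d ≤ |d| := by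
  unfold gr
  split_ifs
  · exact le_rfl
  · exact le_abs_self d
  · exact neg_le_abs d

lemma gr_ev (x d : ℝ) : ∀ᶠ ε in nhdsWithin (0 : ℝ) (Ioi 0), |x + ε * d| ≤ |x| + ε * gr x d := by
  have h0 : ∀ᶠ ε in nhdsWithin (0 : ℝ) (Ioi 0), 0 < ε := eventually_mem_nhdsWithin
  have hc : Filter.Tendsto (fun ε : ℝ => x + ε * d) (nhdsWithin (0 : ℝ) (Ioi 0)) (nhds x) := by
    have : Filter.Tendsto (fun ε : ℝ => x + ε * d) (nhds 0) (nhds (x + 0 * d)) :=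
      Continuous.tendsto (by fun_prop) 0
    simp only [zero_mul, add_zero] at this
    exact this.mono_left nhdsWithin_le_nhds
  unfold gr
  split_ifs with h1 h2
  · filter_upwards [h0] with ε hε
    subst h1
    simp [abs_mul, abs_of_pos hε]
  · filter_upwards [Filter.Tendsto.eventually_const_lt h2 hc] with ε hε
    rw [abs_of_pos hε, abs_of_pos h2]
  · have h3 : x < 0 := lt_of_le_of_ne (not_lt.mp h2) h1
    filter_upwards [Filter.Tendsto.eventually_lt_const h3 hc] with ε hε
    rw [abs_of_neg hε, abs_of_neg h3]
    linarith

lemma dom_mem {n : ℕ} {B : Set (Fin n → ℝ)} (hc : Convex ℝ B) (hu : Unconditional B)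
    {y z : Fin n → ℝ} (hz : z ∈ B) (h : ∀ i, |y i| ≤ |z i|) : y ∈ B := by
  have h1 : y ∈ (univ : Set (Fin n)).pi (fun i => convexHull ℝ ({z i, -z i} : Set ℝ)) := by
    intro i _
    change y i ∈ convexHull ℝ ({z i, -z i} : Set ℝ)
    rw [convexHull_pair, segment_eq_uIcc]
    have := abs_le.mp (h i)
    rcases le_total 0 (z i) with h0 | h0
    · rw [abs_of_nonneg h0] at this
      rw [uIcc_comm, uIcc_of_le (by linarith)]
      exact this
    · rw [abs_of_nonpos h0] at this
      rw [uIcc_of_le (by linarith)]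
      exact ⟨by linarith [this.1], this.2⟩
  rw [← convexHull_pi] at h1
  refine convexHull_min ?_ hc h1
  intro w hw
  have hw' : ∀ i, w i = z i ∨ w i = -z i := fun i => by simpa using hw i (mem_univ i)
  have := hu z hz (fun i => if w i = z i then 1 else -1) (fun i => by
    by_cases hh : w i = z i <;> simp [hh])
  convert this using 1
  ext i
  by_cases hh : w i = z i
  · simp [hh]
  · simp [hh, (hw' i).resolve_left hh]

lemma box_int {n : ℕ} {B : Set (Fin n → ℝ)} (hc : Convex ℝ B) (hu : Unconditional B)
    {y z : Fin n → ℝ} (hz : z ∈ B) (h : ∀ i, |y i| < z i) : y ∈ interior B := by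
  have hopen : IsOpen {w : Fin n → ℝ | ∀ i, |w i| < z i} := by
    rw [ofPred_forall]
    exact isOpen_iInter_of_finite fun i => isOpen_lt (by fun_prop) continuous_const
  exact interior_maximal (fun w hw => dom_mem hc hu hz
    (fun i => (hw i).le.trans (le_abs_self _))) hopen h

lemma abs_le_one {n : ℕ} {B : Set (Fin n → ℝ)} (hB : memU B) {x : Fin n → ℝ} (hx : x ∈ B)
    (i : Fin n) : |x i| ≤ 1 := by
  obtain ⟨⟨hc, hcomp, w, hw⟩, hu, he⟩ := hB
  by_contra hcon
  push Not at hcon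
  have hnw : -w ∈ B := by
    refine dom_mem hc hu (interior_subset hw) (fun i => by simp)
  have h0 : (0 : Fin n → ℝ) ∈ interior B := by
    have := hc.combo_interior_self_mem_interior hw hnw (a := 1/2) (b := 1/2)
      (by norm_num) (by norm_num) (by norm_num)
    simpa using this
  have hxi : (|x i| • stdB i : Fin n → ℝ) ∈ B := by
    refine dom_mem hc hu hx (fun l => ?_)
    by_cases hl : l = i
    · subst hl; simp [stdB]
    · simp [stdB, hl]
  have hpos : 0 < |x i| := by linarith
  have := hc.combo_interior_self_mem_interior h0 hxi (a := 1 - 1/|x i|) (b := 1/|x i|)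
    (by rw [sub_pos, div_lt_one hpos]; exact hcon) (by positivity) (by ring)
  rw [smul_zero, zero_add, smul_smul, one_div_mul_cancel hpos.ne', one_smul] at this
  exact (he i).2 this

lemma illum_of {n : ℕ} {B : Set (Fin n → ℝ)} (hc : Convex ℝ B) (hu : Unconditional B)
    {x d z : Fin n → ℝ} (hx : x ∈ B) (hz : z ∈ B) (c : ℝ) (hc0 : 0 < c)
    (h : ∀ i, gr (x i) (d i) < c * (z i - |x i|)) : Illuminates B d x := by
  have h0 : ∀ᶠ ε in nhdsWithin (0 : ℝ) (Ioi 0), 0 < ε := eventually_mem_nhdsWithin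
  have h1 : ∀ᶠ ε in nhdsWithin (0 : ℝ) (Ioi 0), ε < 1 / c :=
    nhdsWithin_le_nhds (eventually_lt_nhds (by positivity))
  have h2 : ∀ᶠ ε in nhdsWithin (0 : ℝ) (Ioi 0), ∀ i,
      |x i + ε * d i| ≤ |x i| + ε * gr (x i) (d i) :=
    Filter.eventually_all.mpr fun i => gr_ev _ _
  obtain ⟨ε, e0, e1, e2⟩ := (h0.and (h1.and h2)).exists
  refine ⟨ε, e0, ?_⟩
  have hax : (fun i => |x i|) ∈ B := dom_mem hc hu hx (fun i => by simp)
  rw [lt_div_iff₀ hc0] at e1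
  have hy := hc hax hz (a := 1 - ε * c) (b := ε * c) (by linarith) (by positivity) (by ring)
  refine box_int hc hu hy (fun i => ?_)
  have := mul_lt_mul_of_pos_left (h i) e0
  have e3 := e2 i
  simp only [Pi.add_apply, Pi.smul_apply, smul_eq_mul]
  nlinarith

lemma illum_P {n : ℕ} {B : Set (Fin n → ℝ)} (hc : Convex ℝ B) (hu : Unconditional B)
    {T : Finset (Fin n)} (hT : ∀ l ∈ T, allOnes - stdB l ∈ B)
    {x d : Fin n → ℝ} (hx : x ∈ B) (c : ℝ) (hc0 : 0 < c)
    (h : ∀ i, gr (x i) (d i) < c * (1 - |x i|))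
    (h3 : c < ∑ l ∈ T, (c * (1 - |x l|) - gr (x l) (d l))) : Illuminates B d x := by
  set u : Fin n → ℝ := fun l => c * (1 - |x l|) - gr (x l) (d l) with hu'
  set s := ∑ l ∈ T, u l with hs
  have hs0 : 0 < s := hc0.trans h3
  have hupos : ∀ l, 0 < u l := fun l => by have := h l; simp only [hu']; linarith
  have hz := hc.sum_mem (t := T) (w := fun l => u l / s) (z := fun l => allOnes - stdB l)
    (fun l _ => (div_pos (hupos l) hs0).le) (by rw [← Finset.sum_div, ← hs, div_self hs0.ne'])
    hT
  refine illum_of hc hu hx hz c hc0 (fun i => ?_)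
  have hw : ∑ l ∈ T, u l / s = 1 := by rw [← Finset.sum_div, ← hs, div_self hs0.ne']
  have hzi : (∑ l ∈ T, (u l / s) • (allOnes - stdB l : Fin n → ℝ)) i
      = 1 - if i ∈ T then u i / s else 0 := by
    simp only [Finset.sum_apply, Pi.smul_apply, Pi.sub_apply, smul_eq_mul, allOnes, stdB,
      mul_sub, mul_one, Finset.sum_sub_distrib, hw, Pi.single_apply, mul_ite, mul_zero,
      Finset.sum_ite_eq]
  rw [hzi]
  split_ifs with hi
  · have h4 : c * (u i / s) < u i := by
      rw [mul_div_assoc', div_lt_iff₀ hs0, mul_comm]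
      exact mul_lt_mul_of_pos_left h3 (hupos i)
    have h5 : u i = c * (1 - |x i|) - gr (x i) (d i) := rfl
    nlinarith
  · have := h i
    simpa using this

/-- Uniform gap. -/
lemma gap {n : ℕ} {B : Set (Fin n → ℝ)} (hB : memU B) (S : Finset (Fin n))
    (hS : ∀ i ∈ S, allOnes - stdB i ∉ B) :
    ∃ η : ℝ, 0 < η ∧ η < 1 ∧ ∀ x ∈ B, ∀ i ∈ S, ∃ l, l ≠ i ∧ |x l| ≤ 1 - η := by
  obtain ⟨⟨hc, hcomp, -⟩, hu, -⟩ := hB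
  have h1 : ∀ᶠ t in nhdsWithin (1 : ℝ) (Iio 1), ∀ i ∈ S,
      t • (allOnes - stdB i : Fin n → ℝ) ∉ B := by
    refine Filter.Eventually.filter_mono nhdsWithin_le_nhds ?_
    rw [Filter.eventually_all_finset]
    intro i hi
    have hcont : Filter.Tendsto (fun t : ℝ => t • (allOnes - stdB i : Fin n → ℝ)) (nhds 1)
        (nhds ((1 : ℝ) • (allOnes - stdB i : Fin n → ℝ))) :=
      Continuous.tendsto (by fun_prop) 1
    rw [one_smul] at hcont
    exact hcont (hcomp.isClosed.isOpen_compl.mem_nhds (hS i hi))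
  have h2 : ∀ᶠ t in nhdsWithin (1 : ℝ) (Iio 1), t < 1 := eventually_mem_nhdsWithin
  have h3 : ∀ᶠ t in nhdsWithin (1 : ℝ) (Iio 1), 0 < t :=
    nhdsWithin_le_nhds (eventually_gt_nhds (by norm_num))
  obtain ⟨t, t1, t2, t3⟩ := (h1.and (h2.and h3)).exists
  refine ⟨1 - t, by linarith, by linarith, fun x hx i hi => ?_⟩
  by_contra hcon
  push Not at hcon
  refine t1 i hi (dom_mem hc hu hx (fun l => ?_))
  by_cases hl : l = i
  · subst hl; simp [allOnes, stdB]
  · have := hcon l hl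
    simp [allOnes, stdB, hl, abs_of_pos t3]
    linarith

section patterns

variable {n : ℕ}

/-- Flip one coordinate. -/
def flp (p : Fin n → ℤˣ) (l : Fin n) : Fin n → ℤˣ := Function.update p l (-p l)

lemma flp_self (p : Fin n → ℤˣ) (l : Fin n) : flp p l l = -p l := by simp [flp]

lemma flp_ne (p : Fin n → ℤˣ) {l i : Fin n} (h : i ≠ l) : flp p l i = p i := by simp [flp, h]

lemma flp_neg (p : Fin n → ℤˣ) (l : Fin n) : flp (-p) l = -flp p l := by
  ext i
  by_cases h : i = l
  · subst h; simp [flp]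
  · simp [flp, h]

/-- The dropped patterns. -/
def Drop (T S' : Finset (Fin n)) (j0 : Fin n) (p : Fin n → ℤˣ) : Prop :=
  ∃ e : ℤˣ, ∀ l ∈ T, p l = e * (if l = j0 then ∏ i ∈ S', p i else 1)

lemma chi_neg {S' : Finset (Fin n)} (hS : Even S'.card) (p : Fin n → ℤˣ) :
    ∏ i ∈ S', (-p) i = ∏ i ∈ S', p i := by
  simp only [Pi.neg_apply]
  rw [Finset.prod_neg, hS.neg_one_pow, one_mul]

lemma drop_neg {T S' : Finset (Fin n)} {j0 : Fin n} (hS : Even S'.card) {p : Fin n → ℤˣ}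
    (h : Drop T S' j0 p) : Drop T S' j0 (-p) := by
  obtain ⟨e, he⟩ := h
  refine ⟨-e, fun l hl => ?_⟩
  rw [chi_neg hS, Pi.neg_apply, he l hl, neg_mul]

lemma drop_neg_iff {T S' : Finset (Fin n)} {j0 : Fin n} (hS : Even S'.card) {p : Fin n → ℤˣ} :
    Drop T S' j0 (-p) ↔ Drop T S' j0 p :=
  ⟨fun h => by simpa using drop_neg hS h, drop_neg hS⟩

lemma chi_congr {S' : Finset (Fin n)} {p q : Fin n → ℤˣ} (h : ∀ i ∈ S', p i = q i) :
    ∏ i ∈ S', p i = ∏ i ∈ S', q i := Finset.prod_congr rfl h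

/-- Two dropped patterns with the same sign product that agree somewhere in `T` agree on `T`. -/
lemma drop_eq {T S' : Finset (Fin n)} {j0 : Fin n} {p q : Fin n → ℤˣ}
    (hp : Drop T S' j0 p) (hq : Drop T S' j0 q) (h : ∀ i ∈ S', p i = q i)
    {l : Fin n} (hl : l ∈ T) (hpq : p l = q l) {i : Fin n} (hi : i ∈ T) : p i = q i := by
  obtain ⟨e, he⟩ := hp
  obtain ⟨e', he'⟩ := hq
  have h1 : e = e' := by
    rw [he l hl, he' l hl, chi_congr h] at hpq
    exact mul_right_cancel hpq
  rw [he i hi, he' i hi, chi_congr h, h1]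

lemma unit_ne_neg (u : ℤˣ) : u ≠ -u := by
  rcases Int.units_eq_one_or u with h | h <;> subst h <;> decide

lemma drop_flip {T S' : Finset (Fin n)} {j0 : Fin n} (hd : Disjoint T S') (hT : 3 ≤ T.card)
    {p : Fin n → ℤˣ} (hp : Drop T S' j0 p) {l : Fin n} (hl : l ∈ T) :
    ¬ Drop T S' j0 (flp p l) := by
  intro hq
  obtain ⟨l', hl', hne⟩ := Finset.exists_mem_ne (show 1 < T.card by omega) l
  have := drop_eq hp hq (fun i hi => (flp_ne p (fun h => by
    subst h; exact Finset.disjoint_left.mp hd hl hi)).symm) hl' (flp_ne p hne).symm hl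
  rw [flp_self] at this
  exact unit_ne_neg _ this

lemma drop_uniq {T S' : Finset (Fin n)} {j0 : Fin n} (hd : Disjoint T S') (hT : 3 ≤ T.card)
    {p : Fin n → ℤˣ} {l l' : Fin n} (hl : l ∈ T) (hl' : l' ∈ T)
    (hp : Drop T S' j0 (flp p l)) (hq : Drop T S' j0 (flp p l')) : l = l' := by
  by_contra hne
  obtain ⟨m, hm⟩ : ((T.erase l).erase l').Nonempty := by
    rw [← Finset.card_pos]
    have h1 := Finset.pred_card_le_card_erase (s := T) (a := l)
    have h2 := Finset.pred_card_le_card_erase (s := T.erase l) (a := l')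
    omega
  simp only [Finset.mem_erase] at hm
  obtain ⟨m1, m2, m3⟩ := hm
  have := drop_eq hp hq (fun i hi => by
    rw [flp_ne, flp_ne]
    · rintro rfl; exact Finset.disjoint_left.mp hd hl' hi
    · rintro rfl; exact Finset.disjoint_left.mp hd hl hi) m3
    (by rw [flp_ne _ m2, flp_ne _ m1]) hl
  rw [flp_self, flp_ne _ hne] at this
  exact unit_ne_neg _ this.symm

lemma drop_S {T S' : Finset (Fin n)} {j0 : Fin n} (hd : Disjoint T S') (hT : 3 ≤ T.card)
    (hj : j0 ∈ T)
    {p : Fin n → ℤˣ} (hp : Drop T S' j0 p) {i : Fin n} (hi : i ∈ S') :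
    ¬ Drop T S' j0 (flp p i) := by
  rintro ⟨e', he'⟩
  obtain ⟨e, he⟩ := hp
  have hiT : ∀ l ∈ T, l ≠ i := fun l hl h => by
    subst h; exact Finset.disjoint_left.mp hd hl hi
  obtain ⟨l', hl', hne⟩ := Finset.exists_mem_ne (show 1 < T.card by omega) j0
  have h1 := he l' hl'
  have h2 := he' l' hl'
  rw [flp_ne _ (hiT _ hl')] at h2
  simp only [hne, if_false, mul_one] at h1 h2
  have h3 := he j0 hj
  have h4 := he' j0 hj
  rw [flp_ne _ (hiT _ hj)] at h4
  simp only [if_true] at h3 h4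
  have h5 : ∏ m ∈ S', flp p i m = - ∏ m ∈ S', p m := by
    rw [← Finset.mul_prod_erase _ _ hi, ← Finset.mul_prod_erase _ _ hi, flp_self, neg_mul]
    congr 2
    exact Finset.prod_congr rfl fun m hm => flp_ne _ (Finset.ne_of_mem_erase hm)
  rw [h5, ← h2, h1, h3, mul_neg] at h4
  exact unit_ne_neg _ h4

open Classical in
lemma drop_card {T S S' : Finset (Fin n)} {j0 : Fin n} (hS : S = Tᶜ) (hS' : S' ⊆ S)
    (hT : 3 ≤ T.card) :
    2 ^ (S.card + 1) ≤ (Finset.univ.filter (Drop T S' j0)).card := by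
  have hmS : ∀ l, l ∈ S ↔ l ∉ T := fun l => by rw [hS, Finset.mem_compl]
  have hcard : Fintype.card ((S → ℤˣ) × ℤˣ) = 2 ^ (S.card + 1) := by
    simp [pow_succ]
  rw [← hcard, ← Finset.card_univ]
  let X : (S → ℤˣ) → Fin n → ℤˣ := fun σ i => if h : i ∈ S then σ ⟨i, h⟩ else 1
  refine Finset.card_le_card_of_injOn
    (fun q l => if h : l ∈ S then q.1 ⟨l, h⟩ else
      q.2 * (if l = j0 then ∏ i ∈ S', X q.1 i else 1)) ?_ ?_
  · rintro ⟨σ, e⟩ -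
    simp only [Finset.coe_filter, Finset.mem_univ, true_and, mem_ofPred_eq]
    refine ⟨e, fun l hl => ?_⟩
    have : l ∉ S := by rw [hmS]; simpa using hl
    simp only [this, dif_neg, not_false_eq_true]
    congr 2
    refine Finset.prod_congr rfl fun i hi => ?_
    simp [X, hS' hi]
  · rintro ⟨σ, e⟩ - ⟨σ', e'⟩ - heq
    obtain ⟨l', hl', hne⟩ := Finset.exists_mem_ne (show 1 < T.card by omega) j0
    have h1 : e = e' := by
      have := congrFun heq l'
      have h2 : l' ∉ S := by rw [hmS]; simpa using hl'
      simpa [h2, hne] using this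
    have h2 : σ = σ' := by
      ext ⟨i, hi⟩
      have := congrFun heq i
      simp only [hi, dif_pos] at this
      rw [this]
    rw [h1, h2]

open Classical in
/-- Magnitudes. -/
noncomputable def mag (T S' : Finset (Fin n)) (j0 : Fin n) (δ : ℝ) (p : Fin n → ℤˣ)
    (l : Fin n) : ℝ := if l ∈ T ∧ ¬ Drop T S' j0 (flp p l) then 1 else δ

/-- Directions. -/
noncomputable def dir (T S' : Finset (Fin n)) (j0 : Fin n) (δ : ℝ) (p : Fin n → ℤˣ) :
    Fin n → ℝ := fun l => ((p l : ℤ) : ℝ) * mag T S' j0 δ p l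

lemma dir_neg {T S' : Finset (Fin n)} {j0 : Fin n} {δ : ℝ} (hS : Even S'.card)
    (p : Fin n → ℤˣ) : dir T S' j0 δ (-p) = - dir T S' j0 δ p := by
  ext l
  have h : mag T S' j0 δ (-p) l = mag T S' j0 δ p l := by
    unfold mag
    have h1 : Drop T S' j0 (flp (-p) l) ↔ Drop T S' j0 (flp p l) := by
      rw [flp_neg, drop_neg_iff hS]
    by_cases h2 : Drop T S' j0 (flp p l) <;> simp [h1, h2]
  simp [dir, h]

lemma mag_mem (T S' : Finset (Fin n)) (j0 : Fin n) (δ : ℝ) (p : Fin n → ℤˣ)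
    (l : Fin n) : mag T S' j0 δ p l = 1 ∨ mag T S' j0 δ p l = δ := by
  unfold mag; split_ifs <;> simp

lemma mag_pair {T S' : Finset (Fin n)} {j0 : Fin n} (hd : Disjoint T S') (hT : 3 ≤ T.card)
    (δ : ℝ) (p : Fin n → ℤˣ) {l l' : Fin n} (hl : l ∈ T) (hl' : l' ∈ T) (hne : l ≠ l') :
    mag T S' j0 δ p l = 1 ∨ mag T S' j0 δ p l' = 1 := by
  by_cases h1 : Drop T S' j0 (flp p l)
  · right
    have : ¬ Drop T S' j0 (flp p l') := fun h2 => hne (drop_uniq hd hT hl hl' h1 h2)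
    simp [mag, hl', this]
  · left
    simp [mag, hl, h1]

lemma mag_S {T S' : Finset (Fin n)} {j0 : Fin n} {δ : ℝ} {p : Fin n → ℤˣ} {l : Fin n}
    (hl : l ∉ T) : mag T S' j0 δ p l = δ := by simp [mag, hl]

lemma abs_unit (u : ℤˣ) (a : ℝ) : |((u : ℤ) : ℝ) * a| = |a| := by
  rcases Int.units_eq_one_or u with h | h <;> subst h <;> simp

/-- The sign pattern opposite to `x`. -/
noncomputable def opp (x : Fin n → ℝ) : Fin n → ℤˣ := fun l => if 0 < x l then -1 else 1

lemma gr_opp (x : Fin n → ℝ) (l : Fin n) (a : ℝ) (h : x l ≠ 0) :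
    gr (x l) (((opp x l : ℤˣ) : ℤ) * a) = -a := by
  unfold gr opp
  by_cases h0 : 0 < x l <;> simp [h, h0]

end patterns

/-- Three distinct elements, the first prescribed. -/
lemma two_more {n : ℕ} {T : Finset (Fin n)} (hT : 3 ≤ T.card) {j : Fin n} :
    ∃ a ∈ T, ∃ b ∈ T, a ≠ j ∧ b ≠ j ∧ a ≠ b := by
  have h1 := Finset.pred_card_le_card_erase (s := T) (a := j)
  obtain ⟨a, ha, b, hb, hab⟩ := Finset.one_lt_card.mp (show 1 < (T.erase j).card by omega)
  rw [Finset.mem_erase] at ha hb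
  exact ⟨a, ha.2, b, hb.2, ha.1, hb.1, hab⟩

lemma two_le_sum {n : ℕ} {T : Finset (Fin n)} {u : Fin n → ℝ} (hu : ∀ l ∈ T, 0 < u l)
    {a b : Fin n} (ha : a ∈ T) (hb : b ∈ T) (hab : a ≠ b) : u a + u b ≤ ∑ l ∈ T, u l := by
  rw [← Finset.sum_pair hab]
  exact Finset.sum_le_sum_of_subset_of_nonneg (by
    intro i; simp only [Finset.mem_insert, Finset.mem_singleton]; rintro (rfl | rfl) <;> assumption)
    (fun i hi _ => (hu i hi).le)

lemma three_le_sum {n : ℕ} {T : Finset (Fin n)} {u : Fin n → ℝ} (hu : ∀ l ∈ T, 0 < u l)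
    {j a b : Fin n} (hj : j ∈ T) (ha : a ∈ T) (hb : b ∈ T) (haj : a ≠ j) (hbj : b ≠ j)
    (hab : a ≠ b) : u j + u a + u b ≤ ∑ l ∈ T, u l := by
  have h1 := two_le_sum (T := T.erase j) (u := u)
    (fun l hl => hu l (Finset.mem_of_mem_erase hl))
    (Finset.mem_erase.mpr ⟨haj, ha⟩) (Finset.mem_erase.mpr ⟨hbj, hb⟩) hab
  rw [← Finset.add_sum_erase T u hj]
  linarith

/-- The unit-scale illumination criterion. -/
lemma illum_one {n : ℕ} {B : Set (Fin n → ℝ)} (hB : memU B)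
    {T : Finset (Fin n)} (hT : ∀ l ∈ T, allOnes - stdB l ∈ B)
    {x d : Fin n → ℝ} (hx : x ∈ B)
    (h : ∀ i, gr (x i) (d i) < 1 - |x i|) {a b : Fin n} (ha : a ∈ T) (hb : b ∈ T)
    (hab : a ≠ b) (hga : gr (x a) (d a) = -1) (hgb : gr (x b) (d b) = -1) :
    Illuminates B d x := by
  refine illum_P hB.1.1 hB.2.1 hT hx 1 one_pos (by simpa using h) ?_
  have h1 := two_le_sum (T := T) (u := fun l => 1 * (1 - |x l|) - gr (x l) (d l))
    (fun l _ => by have := h l; linarith) ha hb hab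
  have h2 := abs_le_one hB hx a
  have h3 := abs_le_one hB hx b
  simp only [hga, hgb] at h1
  linarith

/-- The large-slack illumination criterion. -/
lemma illum_big {n : ℕ} {B : Set (Fin n → ℝ)} (hB : memU B)
    {T : Finset (Fin n)} (hT : ∀ l ∈ T, allOnes - stdB l ∈ B)
    {x d : Fin n → ℝ} (hx : x ∈ B) (hs : 1 < ∑ l ∈ T, (1 - |x l|))
    (h : ∀ i, |x i| = 1 → gr (x i) (d i) < 0) : Illuminates B d x := by
  have key : ∀ a b : ℝ, 0 < a → ∀ᶠ c : ℝ in Filter.atTop, b < c * a := fun a b ha =>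
    (Filter.tendsto_id.atTop_mul_const ha).eventually_gt_atTop b
  have h1 : ∀ᶠ c : ℝ in Filter.atTop, ∀ i, gr (x i) (d i) < c * (1 - |x i|) := by
    refine Filter.eventually_all.mpr fun i => ?_
    rcases (abs_le_one hB hx i).lt_or_eq with h1 | h1
    · exact key _ _ (by linarith)
    · have := h i h1
      simp [h1, this]
  have h2 := key (∑ l ∈ T, (1 - |x l|) - 1) (∑ l ∈ T, gr (x l) (d l)) (by linarith)
  obtain ⟨c, c1, c2, c3⟩ := (h1.and (h2.and (Filter.eventually_gt_atTop 0))).exists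
  refine illum_P hB.1.1 hB.2.1 hT hx c c3 c1 ?_
  rw [Finset.sum_sub_distrib, ← Finset.mul_sum]
  linarith

lemma main_illum {n : ℕ} {B : Set (Fin n → ℝ)} (hB : memU B) {T S' : Finset (Fin n)}
    {j0 : Fin n} (hT : ∀ l ∈ T, allOnes - stdB l ∈ B) (hT3 : 3 ≤ T.card) (hj0 : j0 ∈ T)
    (hd : Disjoint T S') (hS' : ∀ i i', i ∉ T → i' ∉ T → i ≠ i' → i ∈ S' ∨ i' ∈ S')
    {η δ : ℝ} (hδ0 : 0 < δ) (hδ : δ < η) (hη1 : η < 1)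
    {i0 : Fin n} (hi0 : i0 ∉ T)
    (hgap : ∀ x ∈ B, ∀ i, i ∉ T → ∃ l, l ≠ i ∧ |x l| ≤ 1 - η)
    {x : Fin n → ℝ} (hx : x ∈ B) :
    ∃ p, ¬ Drop T S' j0 p ∧ Illuminates B (dir T S' j0 δ p) x := by
  have hx1 := abs_le_one hB hx
  have hmag : ∀ p l, 0 < mag T S' j0 δ p l ∧ mag T S' j0 δ p l ≤ 1 := fun p l => by
    rcases mag_mem T S' j0 δ p l with h | h <;> rw [h] <;> constructor <;> linarith
  have habs : ∀ p l, |dir T S' j0 δ p l| = mag T S' j0 δ p l := fun p l => by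
    rw [dir, abs_unit, abs_of_pos (hmag p l).1]
  -- matched coordinates
  have hmatch : ∀ p l, p l = opp x l → x l ≠ 0 →
      gr (x l) (dir T S' j0 δ p l) = - mag T S' j0 δ p l := fun p l h h0 => by
    rw [dir, h, gr_opp x l _ h0]
  by_cases hj : ∃ j ∈ T, |x j| ≤ 1 - η
  · obtain ⟨j, hjT, hxj⟩ := hj
    -- a pattern matching off `j`, and small at `j` if mismatched
    obtain ⟨p, hpF, hp1, hp2⟩ : ∃ p, ¬ Drop T S' j0 p ∧ (∀ l, l ≠ j → p l = opp x l) ∧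
        (p j = opp x j ∨ mag T S' j0 δ p j = δ) := by
      by_cases hF : Drop T S' j0 (opp x)
      · refine ⟨flp (opp x) j, drop_flip hd hT3 hF hjT, fun l hl => flp_ne _ hl, Or.inr ?_⟩
        have : flp (flp (opp x) j) j = opp x := by simp [flp]
        simp [mag, this, hF]
      · exact ⟨opp x, hF, fun _ _ => rfl, Or.inl rfl⟩
    refine ⟨p, hpF, ?_⟩
    obtain ⟨a, ha, b, hb, haj, hbj, hab⟩ := two_more hT3 (j := j)
    by_cases hs : 1 < ∑ l ∈ T, (1 - |x l|)
    · refine illum_big hB hT hx hs (fun i hi => ?_)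
      have h0 : x i ≠ 0 := by intro h; simp [h] at hi
      have hij : i ≠ j := by rintro rfl; linarith
      rw [hmatch p i (hp1 i hij) h0]
      linarith [(hmag p i).1]
    · by_cases hz : ∃ l ∈ T, x l = 0
      · obtain ⟨l0, hl0, hxl0⟩ := hz
        have hone : ∀ l ∈ T, l ≠ l0 → |x l| = 1 := by
          intro l hl hne
          refine le_antisymm (hx1 l) ?_
          have h1 : ∑ i ∈ ({l, l0} : Finset (Fin n)), (1 - |x i|) ≤ ∑ i ∈ T, (1 - |x i|) :=
            Finset.sum_le_sum_of_subset_of_nonneg (by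
              intro i; simp only [Finset.mem_insert, Finset.mem_singleton]
              rintro (rfl | rfl) <;> assumption)
              (fun i _ _ => by linarith [hx1 i])
          rw [Finset.sum_pair hne, hxl0, abs_zero] at h1
          linarith
        have hjl : j = l0 := by
          by_contra hne
          have := hone j hjT hne
          linarith
        subst hjl
        have hga : gr (x a) (dir T S' j0 δ p a) = - mag T S' j0 δ p a :=
          hmatch p a (hp1 a haj) (by intro h; have := hone a ha haj; simp [h] at this)
        have hgb : gr (x b) (dir T S' j0 δ p b) = - mag T S' j0 δ p b :=
          hmatch p b (hp1 b hbj) (by intro h; have := hone b hb hbj; simp [h] at this)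
        have hgj : gr (x j) (dir T S' j0 δ p j) ≤ mag T S' j0 δ p j :=
          (gr_le _ _).trans (habs p j).le
        have hall : ∀ i, gr (x i) (dir T S' j0 δ p i) < 2 * (1 - |x i|) := by
          intro i
          by_cases h0 : x i = 0
          · have h1 := (gr_le (x i) (dir T S' j0 δ p i)).trans (habs p i).le
            have h2 := (hmag p i).2
            rw [h0, abs_zero]
            rw [h0] at h1
            linarith
          · rw [hmatch p i (hp1 i (by rintro rfl; exact h0 hxl0)) h0]
            linarith [(hmag p i).1, hx1 i]
        refine illum_P hB.1.1 hB.2.1 hT hx 2 two_pos hall ?_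
        have h3 := three_le_sum (T := T)
          (u := fun l => 2 * (1 - |x l|) - gr (x l) (dir T S' j0 δ p l))
          (fun l _ => by have := hall l; linarith) hjT ha hb haj hbj hab
        refine lt_of_lt_of_le ?_ h3
        simp only [hga, hgb, hone a ha haj, hone b hb hbj, hxl0, abs_zero]
        rw [hxl0] at hgj
        have := hmag p a
        have := hmag p b
        have := hmag p j
        rcases mag_pair (S' := S') (j0 := j0) hd hT3 δ p ha hb hab with h | h <;> linarith
      · push Not at hz
        have hall : ∀ i, gr (x i) (dir T S' j0 δ p i) < 1 - |x i| := by
          intro i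
          by_cases hij : i = j
          · subst hij
            rcases hp2 with h | h
            · rw [hmatch p i h (hz i hjT)]
              linarith [(hmag p i).1, hx1 i]
            · have h1 := (gr_le (x i) (dir T S' j0 δ p i)).trans (habs p i).le
              linarith
          · by_cases h0 : x i = 0
            · have hiT : i ∉ T := fun h => hz i h h0
              have h1 := (gr_le (x i) (dir T S' j0 δ p i)).trans (habs p i).le
              rw [mag_S hiT] at h1
              rw [h0] at h1 ⊢
              rw [abs_zero]
              linarith
            · rw [hmatch p i (hp1 i hij) h0]
              linarith [(hmag p i).1, hx1 i]
        -- two full matched coordinates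
        have hfull : ∀ l ∈ T, p l = opp x l → mag T S' j0 δ p l = 1 →
            gr (x l) (dir T S' j0 δ p l) = -1 := fun l hl h1 h2 => by
          rw [hmatch p l h1 (hz l hl), h2]
        rcases hp2 with h | h
        · have hall' : ∀ l, p l = opp x l := fun l => by
            by_cases hl : l = j
            · rw [hl, h]
            · exact hp1 l hl
          rcases mag_mem T S' j0 δ p a with h1 | h1
          · rcases mag_pair (S' := S') (j0 := j0) hd hT3 δ p hb hjT hbj with h2 | h2
            · exact illum_one hB hT hx hall ha hb hab (hfull a ha (hall' a) h1)
                (hfull b hb (hall' b) h2)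
            · exact illum_one hB hT hx hall ha hjT haj (hfull a ha (hall' a) h1)
                (hfull j hjT (hall' j) h2)
          · have hne : mag T S' j0 δ p a ≠ 1 := by rw [h1]; linarith
            exact illum_one hB hT hx hall hb hjT hbj
              (hfull b hb (hall' b) ((mag_pair hd hT3 δ p ha hb hab).resolve_left hne))
              (hfull j hjT (hall' j) ((mag_pair hd hT3 δ p ha hjT haj).resolve_left hne))
        · have hne : mag T S' j0 δ p j ≠ 1 := by rw [h]; linarith
          exact illum_one hB hT hx hall ha hb hab
            (hfull a ha (hp1 a haj) ((mag_pair hd hT3 δ p hjT ha haj.symm).resolve_left hne))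
            (hfull b hb (hp1 b hbj) ((mag_pair hd hT3 δ p hjT hb hbj.symm).resolve_left hne))
  · push Not at hj
    have hz : ∀ l ∈ T, x l ≠ 0 := fun l hl h => by
      have := hj l hl
      rw [h, abs_zero] at this
      linarith
    obtain ⟨i1, -, hi1⟩ := hgap x hx i0 hi0
    have hi1T : i1 ∉ T := fun h => by linarith [hj i1 h]
    obtain ⟨i2, hi2ne, hi2⟩ := hgap x hx i1 hi1T
    have hi2T : i2 ∉ T := fun h => by linarith [hj i2 h]
    obtain ⟨i, hiT, hiS, hxi⟩ : ∃ i, i ∉ T ∧ i ∈ S' ∧ |x i| ≤ 1 - η := by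
      rcases hS' i2 i1 hi2T hi1T hi2ne with h | h
      · exact ⟨i2, hi2T, h, hi2⟩
      · exact ⟨i1, hi1T, h, hi1⟩
    obtain ⟨p, hpF, hp1⟩ : ∃ p, ¬ Drop T S' j0 p ∧ (∀ l, l ≠ i → p l = opp x l) := by
      by_cases hF : Drop T S' j0 (opp x)
      · exact ⟨flp (opp x) i, drop_S hd hT3 hj0 hF hiS, fun l hl => flp_ne _ hl⟩
      · exact ⟨opp x, hF, fun _ _ => rfl⟩
    refine ⟨p, hpF, ?_⟩
    have hTi : ∀ l ∈ T, l ≠ i := fun l hl h => hiT (h ▸ hl)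
    have hall : ∀ l, gr (x l) (dir T S' j0 δ p l) < 1 - |x l| := by
      intro l
      by_cases hl : l = i
      · subst hl
        have h1 := (gr_le (x l) (dir T S' j0 δ p l)).trans (habs p l).le
        rw [mag_S hiT] at h1
        linarith
      · by_cases h0 : x l = 0
        · have hlT : l ∉ T := fun h => hz l h h0
          have h1 := (gr_le (x l) (dir T S' j0 δ p l)).trans (habs p l).le
          rw [mag_S hlT] at h1
          rw [h0] at h1 ⊢
          rw [abs_zero]
          linarith
        · rw [hmatch p l (hp1 l hl) h0]
          linarith [(hmag p l).1, hx1 l]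
    have hfull : ∀ l ∈ T, mag T S' j0 δ p l = 1 →
        gr (x l) (dir T S' j0 δ p l) = -1 := fun l hl h2 => by
      rw [hmatch p l (hp1 l (hTi l hl)) (hz l hl), h2]
    obtain ⟨a, ha, b, hb, haj, hbj, hab⟩ := two_more hT3 (j := j0)
    rcases mag_mem T S' j0 δ p a with h1 | h1
    · rcases mag_pair (S' := S') (j0 := j0) hd hT3 δ p hb hj0 hbj with h2 | h2
      · exact illum_one hB hT hx hall ha hb hab (hfull a ha h1) (hfull b hb h2)
      · exact illum_one hB hT hx hall ha hj0 haj (hfull a ha h1) (hfull j0 hj0 h2)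
    · have hne : mag T S' j0 δ p a ≠ 1 := by rw [h1]; linarith
      exact illum_one hB hT hx hall hb hj0 hbj
        (hfull b hb ((mag_pair hd hT3 δ p ha hb hab).resolve_left hne))
        (hfull j0 hj0 ((mag_pair hd hT3 δ p ha hj0 haj).resolve_left hne))

lemma even_sub {n : ℕ} (S : Finset (Fin n)) : ∃ S' ⊆ S, Even S'.card ∧
    ∀ i i', i ∈ S → i' ∈ S → i ≠ i' → i ∈ S' ∨ i' ∈ S' := by
  by_cases h : Even S.card
  · exact ⟨S, subset_rfl, h, fun i i' hi _ _ => Or.inl hi⟩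
  · have h' := Nat.not_even_iff_odd.mp h
    obtain ⟨s, hs⟩ := Finset.card_pos.mp h'.pos
    refine ⟨S.erase s, Finset.erase_subset _ _, ?_, fun i i' hi hi' hne => ?_⟩
    · rw [Finset.card_erase_of_mem hs]
      exact Nat.Odd.sub_odd h' odd_one
    · by_cases his : i = s
      · right
        exact Finset.mem_erase.mpr ⟨fun h => hne (his.trans h.symm), hi'⟩
      · left
        exact Finset.mem_erase.mpr ⟨his, hi⟩

/-- If `B ∈ 𝒰^n` with `k ≥ 2`, `n ≥ k + 3`, and exactly `k`
indices `j` satisfy `𝟙 - e_j ∉ B`, then `B` is illuminated by a symmetric set of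
nonzero directions of cardinality at most `2^n - 6` if `k = 2`, and at most
`2^n - 2^k - 4` if `k ≥ 3`; the illumination number obeys the same bounds. -/
theorem stmt12 (n k : ℕ) (hk : 2 ≤ k) (hn : k + 3 ≤ n)
    (B : Set (Fin n → ℝ)) (hB : memU B)
    (hcard : {j : Fin n | allOnes - stdB j ∉ B}.ncard = k) :
    ∃ D : Finset (Fin n → ℝ), (∀ d ∈ D, d ≠ 0) ∧ (∀ d ∈ D, -d ∈ D) ∧
      IlluminatesSet B ↑D ∧
      (if k = 2 then D.card ≤ 2 ^ n - 6 ∧ illumNumber B ≤ 2 ^ n - 6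
       else D.card ≤ 2 ^ n - 2 ^ k - 4 ∧
         illumNumber B ≤ 2 ^ n - 2 ^ k - 4) := by
  classical
  set S : Finset (Fin n) := Finset.univ.filter (fun j => allOnes - stdB j ∉ B) with hSdef
  have hSc : S.card = k := by
    rw [← hcard, ← Set.ncard_coe_finset]
    congr 1
    ext j
    simp [hSdef]
  set T : Finset (Fin n) := Sᶜ with hTdef
  have hTc : T.card = n - k := by rw [hTdef, Finset.card_compl, Fintype.card_fin, hSc]
  have hT3 : 3 ≤ T.card := by omega
  have hT : ∀ l ∈ T, allOnes - stdB l ∈ B := fun l hl => by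
    simpa [hTdef, hSdef] using hl
  have hST : ∀ l, l ∉ T ↔ l ∈ S := fun l => by simp [hTdef]
  obtain ⟨i0, hi0⟩ : S.Nonempty := Finset.card_pos.mp (by omega)
  obtain ⟨j0, hj0⟩ : T.Nonempty := Finset.card_pos.mp (by omega)
  obtain ⟨S', hS'sub, hS'even, hS'⟩ := even_sub S
  obtain ⟨η, hη0, hη1, hgap⟩ := gap hB S (fun i hi => by simpa [hSdef] using hi)
  have hd : Disjoint T S' := Finset.disjoint_left.mpr fun l hl hl' =>
    ((hST l).mpr (hS'sub hl')) hl
  have hδ0 : 0 < η / 2 := by linarith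
  set P : Finset (Fin n → ℤˣ) := Finset.univ.filter (fun p => ¬ Drop T S' j0 p) with hP
  set D : Finset (Fin n → ℝ) := P.image (dir T S' j0 (η / 2)) with hD
  have hDc : D.card ≤ 2 ^ n - 2 ^ (k + 1) := by
    have h1 : D.card ≤ P.card := Finset.card_image_le
    have h2 := Finset.card_filter_add_card_filter_not (s := (Finset.univ : Finset (Fin n → ℤˣ)))
      (p := Drop T S' j0)
    have h3 := drop_card (T := T) (S := S) (S' := S') (j0 := j0) (by simp [hTdef]) hS'sub hT3
    have h4 : (Finset.univ : Finset (Fin n → ℤˣ)).card = 2 ^ n := by simp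
    rw [hSc] at h3
    rw [h4, ← hP] at h2
    omega
  have hDne : ∀ d ∈ D, d ≠ 0 := by
    intro d hdD h0
    obtain ⟨p, -, rfl⟩ := Finset.mem_image.mp hdD
    have h1 := congrFun h0 i0
    have h2 : |dir T S' j0 (η / 2) p i0| = |η / 2| := by
      rw [dir, abs_unit, mag_S ((hST i0).mpr hi0)]
    rw [h1, abs_of_pos hδ0] at h2
    simp at h2
    linarith
  have hDill : IlluminatesSet B (↑D : Set (Fin n → ℝ)) := by
    intro x hx
    have hxB : x ∈ B := hB.1.2.1.isClosed.frontier_subset hx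
    obtain ⟨p, hp, hill⟩ := main_illum hB hT hT3 hj0 hd
      (fun i i' hi hi' hne => hS' i i' ((hST i).mp hi) ((hST i').mp hi') hne)
      hδ0 (by linarith : η / 2 < η) hη1 ((hST i0).mpr hi0)
      (fun x hx i hi => hgap x hx i ((hST i).mp hi)) hxB
    exact ⟨_, Finset.mem_coe.mpr (Finset.mem_image.mpr ⟨p, by simp [hP, hp], rfl⟩), hill⟩
  have hI : illumNumber B ≤ D.card := Nat.sInf_le ⟨D, rfl, hDne, hDill⟩
  refine ⟨D, hDne, ?_, hDill, ?_⟩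
  · intro d hdD
    obtain ⟨p, hp, rfl⟩ := Finset.mem_image.mp hdD
    refine Finset.mem_image.mpr ⟨-p, ?_, dir_neg hS'even p⟩
    simp only [hP, Finset.mem_filter, Finset.mem_univ, true_and] at hp ⊢
    rwa [drop_neg_iff hS'even]
  · split_ifs with h2
    · subst h2
      norm_num at hDc
      omega
    · have h4 : 2 ^ 2 ≤ 2 ^ k := Nat.pow_le_pow_right (by norm_num) hk
      rw [pow_succ] at hDc
      omega
end

section
/- Let n ≥ 4 and let B ∈ 𝒰^n. Suppose there is exactly one index i₀ ∈ {1,…,n} with 𝟙 − e_{i₀} ∈ B. Then there exists a set D of nonzero directions with D = −D and |D| ≤ 2^n − 4 that illuminates B. In particular 𝕀(B) ≤ 2^n − 4. -/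
open Set

section Comb
variable {ι : Type*} [DecidableEq ι]

lemma uflip (E : Finset ι) (s : ι → ℤˣ) (a : ι) (u : ℤˣ) (ha : a ∈ E) :
    ∏ j ∈ E, Function.update s a (u * s a) j = u * ∏ j ∈ E, s j := by
  rw [← Finset.mul_prod_erase E _ ha, ← Finset.mul_prod_erase E s ha]
  rw [Function.update_self, mul_assoc]
  congr 2
  apply Finset.prod_congr rfl
  intro j hj
  rw [Function.update_of_ne (Finset.ne_of_mem_erase hj)]

lemma uflip' (E : Finset ι) (s : ι → ℤˣ) (a : ι) (u : ℤˣ) (ha : a ∉ E) :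
    ∏ j ∈ E, Function.update s a u j = ∏ j ∈ E, s j := by
  apply Finset.prod_congr rfl
  intro j hj
  rw [Function.update_of_ne]
  rintro rfl
  exact ha hj

lemma uone_ne : (1 : ℤˣ) ≠ -1 := by decide

lemma uneg_ne (u : ℤˣ) : -u ≠ u := by
  rcases Int.units_eq_one_or u with rfl | rfl <;> decide

lemma une {u v : ℤˣ} (h : u ≠ v) : u = -v := by
  rcases Int.units_eq_one_or u with rfl | rfl <;> rcases Int.units_eq_one_or v with rfl | rfl <;>
    simp_all

lemma face_hit [Fintype ι] (hc : 3 ≤ Fintype.card ι) (E : Finset ι)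
    (s : ι → ℤˣ) (a b : ι) (hab : a ≠ b) (ha : a ∈ E) :
    ∃ s' : ι → ℤˣ, (∏ j ∈ E, s' j = 1 ∧ s' ≠ 1 ∧ s' ≠ -1) ∧ ∀ j, j ≠ a → j ≠ b → s' j = s j := by
  obtain ⟨c, hca, hcb⟩ : ∃ c, c ≠ a ∧ c ≠ b := by
    by_contra! h
    have : (Finset.univ : Finset ι) ⊆ {a, b} := by
      intro c _
      by_cases hca : c = a
      · simp [hca]
      · simp [h c hca]
    have h2 := Finset.card_le_card this
    have h3 := Finset.card_le_two (a := a) (b := b)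
    rw [Finset.card_univ] at h2
    omega
  -- adjust at `a`
  have key : ∀ r : ι → ℤˣ, ∃ s' : ι → ℤˣ, ∏ j ∈ E, s' j = 1 ∧ ∀ j, j ≠ a → s' j = r j := by
    intro r
    refine ⟨Function.update r a ((∏ j ∈ E, r j) * r a), ?_, ?_⟩
    · rw [uflip E r a _ ha, Int.units_mul_self]
    · intro j hj
      rw [Function.update_of_ne hj]
  obtain ⟨s1, h1, h1'⟩ := key s
  obtain ⟨s2, h2, h2'⟩ := key (Function.update s b (- s b))
  have e1 : s1 b = s b := h1' b hab.symm
  have e2 : s2 b = - s b := by rw [h2' b hab.symm, Function.update_self]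
  have f1 : s1 c = s c := h1' c hca
  have f2 : s2 c = s c := by rw [h2' c hca, Function.update_of_ne hcb]
  by_cases hs : s1 ≠ 1 ∧ s1 ≠ -1
  · exact ⟨s1, ⟨h1, hs⟩, fun j hj _ => h1' j hj⟩
  · refine ⟨s2, ⟨h2, ?_⟩, fun j hj hj' => by rw [h2' j hj, Function.update_of_ne hj']⟩
    have hsbc : s b = s c := by
      have : s1 = 1 ∨ s1 = -1 := by tauto
      rcases this with h | h <;> rw [← e1, ← f1, h] <;> simp
    constructor <;> intro h <;> rw [h] at e2 f2 <;> rw [hsbc, ← f2] at e2 <;> revert e2 <;>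
      simp only [Pi.one_apply, Pi.neg_apply] <;> decide

lemma comb_aux [Fintype ι] (hc : 3 ≤ Fintype.card ι) (E : Finset ι) (a b : ι) (hab : a ≠ b)
    (hE : Even E.card) (hEb : ∀ j, j ≠ b → j ∈ E) :
    ∃ (T : Finset (ι → ℤˣ)) (sp : (ι → ℤˣ) → ι),
      T.card + 2 ≤ 2 ^ (Fintype.card ι - 1) ∧ (∀ s ∈ T, -s ∈ T) ∧ (∀ s, sp (-s) = sp s) ∧
      (∀ (s : ι → ℤˣ) (i k : ι), i ≠ k → ∃ s' ∈ T, ∀ j, j ≠ i → j ≠ k → s' j = s j) ∧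
      (∀ (s : ι → ℤˣ) (i : ι), (∃ s' ∈ T, ∀ j, j ≠ i → s' j = s j) ∨
        ∃ s', (∀ j, j ≠ i → s' j = s j) ∧ sp s' = i) := by
  classical
  have haE : a ∈ E := hEb a hab
  let N : (ι → ℤˣ) → Finset ι := fun s => Finset.univ.filter (fun j => s j ≠ s a)
  have hNneg : ∀ s, N (-s) = N s := by
    intro s; simp [N]
  let sp : (ι → ℤˣ) → ι := fun s =>
    if h : ∃ j, j ∈ E ∧ N s = {j} then h.choose else if N s = ∅ then a else b
  have sp1 : ∀ s j, j ∈ E → N s = {j} → sp s = j := by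
    intro s j hj hN
    have h : ∃ j, j ∈ E ∧ N s = {j} := ⟨j, hj, hN⟩
    have h2 := h.choose_spec.2
    simp only [sp, dif_pos h]
    exact (Finset.singleton_injective (hN.symm.trans h2)).symm
  have sp2 : ∀ s, N s = ∅ → sp s = a := by
    intro s hs
    simp [sp, hs]
  have sp3 : ∀ s, sp s = b ∨ N s = ∅ ∨ ∃ j ∈ E, N s = {j} := by
    intro s
    by_cases h1 : ∃ j, j ∈ E ∧ N s = {j}
    · right; right; exact h1
    · by_cases h2 : N s = ∅
      · right; left; exact h2
      · left; simp [sp, h1, h2]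
  let S : Finset (ι → ℤˣ) := Finset.univ.filter (fun s => ∏ j ∈ E, s j = 1)
  have h1neg : (1 : ι → ℤˣ) ≠ -1 := by
    intro h
    have := congrFun h a
    exact uone_ne this
  have hnegprod : ∀ s : ι → ℤˣ, ∏ j ∈ E, (-s) j = ∏ j ∈ E, s j := by
    intro s
    simp [Finset.prod_neg, hE.neg_one_pow]
  refine ⟨(S.erase 1).erase (-1), sp, ?_, ?_, ?_, ?_, ?_⟩
  · have hS : S.card * 2 = 2 ^ Fintype.card ι := by
      have e1 : S.card = (Finset.univ.filter (fun s : ι → ℤˣ => ¬ ∏ j ∈ E, s j = 1)).card := by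
        apply Finset.card_bij (fun s _ => Function.update s a (-1 * s a))
        · intro s hs
          simp only [S, Finset.mem_filter, Finset.mem_univ, true_and] at hs ⊢
          rw [uflip E s a _ haE, hs]; decide
        · intro s _ s' _ h
          funext j
          have := congrFun h j
          by_cases hj : j = a
          · subst hj; simpa using this
          · simpa [Function.update_of_ne hj] using this
        · intro s hs
          simp only [Finset.mem_filter, Finset.mem_univ, true_and] at hs
          refine ⟨Function.update s a (-1 * s a), ?_, ?_⟩
          · simp only [S, Finset.mem_filter, Finset.mem_univ, true_and]
            rw [uflip E s a _ haE, une hs]; decide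
          · simp
      have e2 := Finset.card_filter_add_card_filter_not (s := (Finset.univ : Finset (ι → ℤˣ)))
        (fun s : ι → ℤˣ => ∏ j ∈ E, s j = 1)
      have e3 : (Finset.univ : Finset (ι → ℤˣ)).card = 2 ^ Fintype.card ι := by
        simp
      rw [e3] at e2
      change S.card + _ = _ at e2
      omega
    have m1 : (1 : ι → ℤˣ) ∈ S := by simp [S]
    have m2 : (-1 : ι → ℤˣ) ∈ S.erase 1 := by
      rw [Finset.mem_erase]
      refine ⟨h1neg.symm, ?_⟩
      simp only [S, Finset.mem_filter, Finset.mem_univ, true_and]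
      rw [hnegprod]; simp
    have c1 := Finset.card_erase_add_one m1
    have c2 := Finset.card_erase_add_one m2
    have c3 : 2 ^ Fintype.card ι = 2 ^ (Fintype.card ι - 1) * 2 := by
      rw [← pow_succ]; congr 1; omega
    omega
  · intro s hs
    simp only [S, Finset.mem_erase, Finset.mem_filter, Finset.mem_univ, true_and] at hs ⊢
    refine ⟨fun h => hs.2.1 (neg_injective h), fun h => hs.1 ?_, by rw [hnegprod]; exact hs.2.2⟩
    rw [← h, neg_neg]
  · intro s
    simp only [sp, hNneg]
  · intro s i k hik
    have : i ∈ E ∨ k ∈ E := by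
      by_cases h : i = b
      · right; apply hEb; rintro rfl; exact hik h
      · left; exact hEb i h
    rcases this with h | h
    · obtain ⟨s', ⟨h1, h2, h3⟩, h4⟩ := face_hit hc E s i k hik h
      exact ⟨s', by simp [S, h1, h2, h3], h4⟩
    · obtain ⟨s', ⟨h1, h2, h3⟩, h4⟩ := face_hit hc E s k i hik.symm h
      exact ⟨s', by simp [S, h1, h2, h3], fun j hj hj' => h4 j hj' hj⟩
  · intro s i
    have memT : ∀ s : ι → ℤˣ, s ∉ (S.erase 1).erase (-1) → ∏ j ∈ E, s j = 1 → N s = ∅ ∧ ∃ u, ∀ j, s j = u := by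
      intro s hs hp
      have : s = 1 ∨ s = -1 := by
        by_contra! h
        exact hs (by simp [S, hp, h.1, h.2])
      rcases this with rfl | rfl
      · exact ⟨by simp [N], 1, fun j => rfl⟩
      · exact ⟨by simp [N], -1, fun j => rfl⟩
    by_cases hex : ∃ s' ∈ (S.erase 1).erase (-1), ∀ j, j ≠ i → s' j = s j
    · exact Or.inl hex
    right
    push Not at hex
    have hT : ∀ s', (∀ j, j ≠ i → s' j = s j) → s' ∉ (S.erase 1).erase (-1) := by
      intro s' h1 h2
      obtain ⟨j, hj, hj'⟩ := hex s' h2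
      exact hj' (h1 j hj)
    by_cases hi : i ∈ E
    · -- pick the one with product 1
      let r := Function.update s i ((∏ j ∈ E, s j) * s i)
      have hr : ∏ j ∈ E, r j = 1 := by
        simp only [r]; rw [uflip E s i _ hi, Int.units_mul_self]
      have hrs : ∀ j, j ≠ i → r j = s j := fun j hj => by simp [r, Function.update_of_ne hj]
      obtain ⟨hN, u, hu⟩ := memT r (hT r hrs) hr
      by_cases hia : i = a
      · exact ⟨r, hrs, by rw [sp2 r hN, hia]⟩
      · refine ⟨Function.update s i (-u), fun j hj => by rw [Function.update_of_ne hj], sp1 _ i hi ?_⟩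
        ext j
        have hsa : s a = u := by rw [← hrs a (Ne.symm hia), hu]
        simp only [N, Finset.mem_filter, Finset.mem_univ, true_and, Finset.mem_singleton]
        rw [Function.update_of_ne (Ne.symm hia), hsa]
        by_cases hj : j = i
        · subst hj; simp
        · rw [Function.update_of_ne hj, ← hrs j hj, hu]; simp [hj]
    · have hib : i = b := by by_contra h; exact hi (hEb i h)
      subst hib
      let r := Function.update s i (- s i)
      have hrs : ∀ j, j ≠ i → r j = s j := fun j hj => by simp [r, Function.update_of_ne hj]
      have hri : r i = - s i := by simp [r]
      have hsub : ∀ j, j ∈ N s ↔ s j ≠ s a := by intro j; simp [N]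
      have hsubr : ∀ j, j ∈ N r ↔ r j ≠ s a := by intro j; simp [N, hrs a hab]
      have toggle : i ∈ N s ∨ i ∈ N r := by
        rw [hsub, hsubr, hri]
        by_contra! h
        rw [← h.1] at h
        exact uneg_ne _ h.2
      have same : ∀ j, j ≠ i → (j ∈ N s ↔ j ∈ N r) := by
        intro j hj; rw [hsub, hsubr, hrs j hj]
      have hnot : ∀ q : ι → ℤˣ, i ∈ N q → sp q = i := by
        intro q hq
        rcases sp3 q with h | h | ⟨j, hj, h⟩
        · exact h
        · rw [h] at hq; simp at hq
        · rw [h, Finset.mem_singleton] at hq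
          rw [hq] at hi; exact absurd hj hi
      rcases toggle with h | h
      · exact ⟨s, fun _ _ => rfl, hnot s h⟩
      · exact ⟨r, hrs, hnot r h⟩

lemma comb [Fintype ι] (hc : 3 ≤ Fintype.card ι) :
    ∃ (T : Finset (ι → ℤˣ)) (sp : (ι → ℤˣ) → ι),
      T.card + 2 ≤ 2 ^ (Fintype.card ι - 1) ∧ (∀ s ∈ T, -s ∈ T) ∧ (∀ s, sp (-s) = sp s) ∧
      (∀ (s : ι → ℤˣ) (i k : ι), i ≠ k → ∃ s' ∈ T, ∀ j, j ≠ i → j ≠ k → s' j = s j) ∧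
      (∀ (s : ι → ℤˣ) (i : ι), (∃ s' ∈ T, ∀ j, j ≠ i → s' j = s j) ∨
        ∃ s', (∀ j, j ≠ i → s' j = s j) ∧ sp s' = i) := by
  obtain ⟨a, b, hab⟩ := Fintype.exists_pair_of_one_lt_card (α := ι) (by omega)
  rcases Nat.even_or_odd (Fintype.card ι) with h | h
  · exact comb_aux hc Finset.univ a b hab (by simpa using h) (by simp)
  · refine comb_aux hc (Finset.univ.erase b) a b hab ?_ (by simp)
    rw [Finset.card_erase_of_mem (Finset.mem_univ _), Finset.card_univ]
    exact Nat.Odd.sub_odd h odd_one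

end Comb

section Geo
variable {n : ℕ}

lemma box_mono {B : Set (Fin n → ℝ)} (hc : Convex ℝ B) (hu : Unconditional B)
    {x z : Fin n → ℝ} (hx : x ∈ B) (h : ∀ j, |z j| ≤ |x j|) : z ∈ B := by
  classical
  have key : ∀ S : Finset (Fin n), (fun j => if j ∈ S then z j else x j) ∈ B := by
    intro S
    induction S using Finset.induction_on with
    | empty => simpa using hx
    | insert a S ha ih =>
      set p : Fin n → ℝ := fun j => if j ∈ S then z j else x j with hp
      have hpa : p a = x a := by simp [hp, ha]
      let q : Fin n → ℝ := fun j => (if j = a then -1 else 1) * p j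
      have hq : q ∈ B := hu p ih (fun j => if j = a then -1 else 1) (by
        intro i; by_cases hi : i = a <;> simp [hi])
      by_cases hxa : x a = 0
      · have hza : z a = 0 := by
          have := h a; rw [hxa, abs_zero] at this; exact abs_eq_zero.mp (le_antisymm this (abs_nonneg _))
        convert ih using 1
        funext j
        by_cases hj : j = a
        · subst hj; simp [hp, ha, hza, hxa]
        · simp [hp, hj]
      · -- convex combination
        have hr : |z a / x a| ≤ 1 := by
          rw [abs_div]; exact div_le_one_of_le₀ (h a) (abs_nonneg _)
        rw [abs_le] at hr
        have := hc ih hq (a := (1 + z a / x a) / 2) (b := (1 - z a / x a) / 2)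
          (by linarith) (by linarith) (by ring)
        convert this using 1
        funext j
        by_cases hj : j = a
        · subst hj
          simp only [Finset.mem_insert_self, if_true, Pi.add_apply, Pi.smul_apply, smul_eq_mul, q, hpa]
          field_simp
          ring
        · simp only [Finset.mem_insert, hj, false_or, Pi.add_apply, Pi.smul_apply, smul_eq_mul, q, if_false, hp]
          ring
  simpa using key Finset.univ

lemma uncond_interior {B : Set (Fin n → ℝ)} (hu : Unconditional B) :
    Unconditional (interior B) := by
  intro x hx ε hε
  have hcont : Continuous (fun y : Fin n → ℝ => (fun i => ε i * y i)) := by fun_prop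
  have hsq : ∀ i, ε i * ε i = 1 := by
    intro i; rcases hε i with h | h <;> rw [h] <;> norm_num
  have hinv : ∀ y : Fin n → ℝ, (fun i => ε i * (ε i * y i)) = y := by
    intro y; funext i; rw [← mul_assoc, hsq, one_mul]
  have hsub : (fun y : Fin n → ℝ => (fun i => ε i * y i)) ⁻¹' (interior B) ⊆ B := by
    intro y hy
    have := hu _ (interior_subset hy) ε hε
    simpa only [hinv] using this
  apply interior_maximal hsub (isOpen_interior.preimage hcont)
  simp only [Set.mem_preimage, hinv]
  exact hx

lemma zero_interior {B : Set (Fin n → ℝ)} (hb : IsConvexBody B) (hu : Unconditional B) :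
    (0 : Fin n → ℝ) ∈ interior B := by
  obtain ⟨p, hp⟩ := hb.2.2
  exact box_mono hb.1.interior (uncond_interior hu) hp (by simp)

lemma coord_le {B : Set (Fin n → ℝ)} (hB : memU B) {x : Fin n → ℝ} (hx : x ∈ B) (i : Fin n) :
    |x i| ≤ 1 := by
  by_contra! h
  have h0 := zero_interior hB.1 hB.2.1
  have hp : (Pi.single i |x i| : Fin n → ℝ) ∈ B := by
    apply box_mono hB.1.1 hB.2.1 hx
    intro j
    by_cases hj : j = i
    · subst hj; simp
    · simp [hj]
  have hpos : 0 < |x i| := by linarith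
  have := hB.1.1.combo_interior_self_mem_interior h0 hp (a := 1 - 1 / |x i|) (b := 1 / |x i|)
    (by rw [sub_pos]; exact (div_lt_one hpos).mpr h) (by positivity) (by ring)
  have h2 : stdB i ∈ interior B := by
    convert this using 1
    funext j
    by_cases hj : j = i
    · subst hj; simp [stdB, hpos.ne']
    · simp [stdB, hj]
  exact (hB.2.2 i).2 h2

lemma diamond_interior {B : Set (Fin n → ℝ)} (hB : memU B) {i₀ : Fin n}
    (h1 : allOnes - stdB i₀ ∈ B) {z : Fin n → ℝ} (hz0 : |z i₀| < 1)
    (hz : ∀ j, j ≠ i₀ → |z j| + |z i₀| < 1) : z ∈ interior B := by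
  have hclosed : IsClosed B := hB.1.2.1.isClosed
  have he : stdB i₀ ∈ B := hclosed.frontier_subset (hB.2.2 i₀)
  let O : Set (Fin n → ℝ) := {z | |z i₀| < 1} ∩ ⋂ j : Fin n, {z | j ≠ i₀ → |z j| + |z i₀| < 1}
  have hO : IsOpen O := by
    apply IsOpen.inter
    · exact isOpen_lt (by fun_prop) (by fun_prop)
    · apply isOpen_iInter_of_finite
      intro j
      by_cases hj : j = i₀
      · simp [hj]
      · simp only [ne_eq, hj, not_false_eq_true, forall_const]
        exact isOpen_lt (by fun_prop) (by fun_prop)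
  refine interior_maximal (s := B) (t := O) ?_ hO ⟨hz0, by simpa using hz⟩
  rintro z ⟨hz0, hz⟩
  simp only [Set.mem_iInter, Set.mem_ofPred_eq] at hz hz0
  have := hB.1.1 h1 he (show 0 ≤ 1 - |z i₀| by linarith) (abs_nonneg (z i₀)) (by ring)
  apply box_mono hB.1.1 hB.2.1 this
  intro j
  by_cases hj : j = i₀
  · subst hj; simp [stdB, allOnes]
  · have := hz j hj
    simp [stdB, allOnes, hj]
    rw [abs_of_nonneg (show 0 ≤ 1 - |z i₀| by linarith)]
    linarith

lemma exists_delta {B : Set (Fin n → ℝ)} (hB : memU B) {i₀ : Fin n}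
    (h1 : ∀ i, i ≠ i₀ → allOnes - stdB i ∉ B) :
    ∃ δ : ℝ, 0 < δ ∧ δ < 1 / 2 ∧ ∀ x ∈ B, ∀ i, i ≠ i₀ →
      (∀ j, j ≠ i → j ≠ i₀ → 1 - δ ≤ |x j|) → |x i₀| ≤ 1 - δ := by
  have hopen : IsOpen Bᶜ := hB.1.2.1.isClosed.isOpen_compl
  have hex : ∀ i, ∃ θ : ℝ, 0 < θ ∧ (i ≠ i₀ → Metric.ball (allOnes - stdB i) θ ⊆ Bᶜ) := by
    intro i
    by_cases hi : i = i₀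
    · exact ⟨1, one_pos, fun h => absurd hi h⟩
    · obtain ⟨θ, h, h'⟩ := Metric.isOpen_iff.mp hopen _ (h1 i hi)
      exact ⟨θ, h, fun _ => h'⟩
  choose θ hθ hball using hex
  obtain ⟨δ, hδ0, hδ⟩ : ∃ δ : ℝ, 0 < δ ∧ ∀ i, δ < θ i := by
    have : ∀ᶠ δ : ℝ in nhdsWithin 0 (Set.Ioi 0), ∀ i, δ < θ i := by
      rw [Filter.eventually_all]
      intro i
      exact nhdsWithin_le_nhds (eventually_lt_nhds (hθ i))
    obtain ⟨δ, h, h'⟩ := (this.and self_mem_nhdsWithin).exists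
    exact ⟨δ, h', h⟩
  refine ⟨min δ (1 / 4), lt_min hδ0 (by norm_num), (min_le_right _ _).trans_lt (by norm_num), ?_⟩
  intro x hx i hi hxj
  by_contra! hlt
  have hzB : (fun j => if j = i then 0 else |x j|) ∈ B := by
    apply box_mono hB.1.1 hB.2.1 hx
    intro j
    by_cases hj : j = i <;> simp [hj]
  refine hball i hi ?_ hzB
  rw [Metric.mem_ball, dist_pi_lt_iff (hθ i)]
  intro j
  by_cases hj : j = i
  · subst hj; simp [allOnes, stdB, hθ]
  · have hle := coord_le hB hx j
    have hge : 1 - min δ (1/4) ≤ |x j| := by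
      by_cases hj0 : j = i₀
      · subst hj0; exact hlt.le
      · exact hxj j hj hj0
    have := min_le_left δ (1/4)
    have := hδ i
    simp only [hj, if_false, allOnes, stdB, Pi.sub_apply, Real.dist_eq]
    rw [Pi.single_eq_of_ne hj, abs_lt]
    constructor <;> linarith

/-- Assemble a vector from the `i₀`-coordinate and the others. -/
def mkv (i₀ : Fin n) (u : {j : Fin n // j ≠ i₀} → ℝ) (t : ℝ) : Fin n → ℝ :=
  fun k => if h : k = i₀ then t else u ⟨k, h⟩

lemma mkv_self (i₀ : Fin n) (u : {j : Fin n // j ≠ i₀} → ℝ) (t : ℝ) : mkv i₀ u t i₀ = t := by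
  simp [mkv]

lemma mkv_ne (i₀ : Fin n) (u : {j : Fin n // j ≠ i₀} → ℝ) (t : ℝ) (j : {j : Fin n // j ≠ i₀}) :
    mkv i₀ u t j = u j := by
  simp [mkv, j.2]

lemma mkv_neg (i₀ : Fin n) (u : {j : Fin n // j ≠ i₀} → ℝ) (t : ℝ) :
    -mkv i₀ u t = mkv i₀ (-u) (-t) := by
  funext k
  by_cases h : k = i₀ <;> simp [mkv, h]

/-- real value of a sign -/
def sg (u : ℤˣ) : ℝ := ((u : ℤ) : ℝ)

lemma sg_neg (u : ℤˣ) : sg (-u) = -sg u := by simp [sg]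

lemma sg_or (u : ℤˣ) : sg u = 1 ∨ sg u = -1 := by
  rcases Int.units_eq_one_or u with rfl | rfl <;> simp [sg]

lemma opp_lt {y a : ℝ} {u : ℤˣ} (hy : |y| ≤ 1) (hu : sg u * y ≤ 0) (ha : 0 < a) (ha1 : a < 1) :
    |y + a * sg u| < 1 := by
  rw [abs_le] at hy
  rcases sg_or u with h | h <;> rw [h] at hu ⊢ <;> rw [abs_lt] <;> constructor <;> linarith

lemma opp_dec {y a b : ℝ} {u : ℤˣ} (hy : |y| ≤ 1) (hu : sg u * y ≤ 0) (hb : 0 ≤ b) (hab : b ≤ a)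
    (ha1 : a ≤ |y|) :
    |y + a * sg u| ≤ (1 - b) * |y| := by
  have h1 : |y + a * sg u| = |y| - a := by
    rcases sg_or u with h | h <;> rw [h] at hu ⊢
    · rw [abs_of_nonpos (by linarith : y ≤ 0)] at ha1 ⊢
      rw [abs_of_nonpos (by linarith)]; ring
    · rw [abs_of_nonneg (by linarith : 0 ≤ y)] at ha1 ⊢
      rw [abs_of_nonneg (by linarith)]; ring
  rw [h1]
  nlinarith

lemma free_lt {y a : ℝ} {u : ℤˣ} (ha : 0 < a) (hy : |y| + a < 1) : |y + a * sg u| < 1 := by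
  have : |y| < 1 - a := by linarith
  rw [abs_lt] at this
  rcases sg_or u with h | h <;> rw [h, abs_lt] <;> constructor <;> linarith

/-- vertex-type direction -/
noncomputable def dirV (i₀ : Fin n) (δ : ℝ) (sp : ({j : Fin n // j ≠ i₀} → ℤˣ) → {j : Fin n // j ≠ i₀})
    (s : {j : Fin n // j ≠ i₀} → ℤˣ) : Fin n → ℝ :=
  mkv i₀ (fun j => (if sp s = j then δ / 2 else 1) * sg (s j)) 0

/-- flat-type direction -/
noncomputable def dirT (i₀ : Fin n) (δ : ℝ) (c : ℝ) (s : {j : Fin n // j ≠ i₀} → ℤˣ) : Fin n → ℝ :=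
  mkv i₀ (fun j => δ * sg (s j)) c

lemma dirV_neg (i₀ : Fin n) (δ : ℝ) (sp : ({j : Fin n // j ≠ i₀} → ℤˣ) → {j : Fin n // j ≠ i₀})
    (hsp : ∀ s, sp (-s) = sp s)
    (s : {j : Fin n // j ≠ i₀} → ℤˣ) : -dirV i₀ δ sp s = dirV i₀ δ sp (-s) := by
  simp only [dirV, mkv_neg, neg_zero, hsp]
  congr 1
  funext j
  simp [sg_neg]

lemma dirT_neg (i₀ : Fin n) (δ c : ℝ) (s : {j : Fin n // j ≠ i₀} → ℤˣ) :
    -dirT i₀ δ c s = dirT i₀ δ (-c) (-s) := by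
  simp only [dirT, mkv_neg]
  congr 1
  funext j
  simp [sg_neg]

/-- Flat directions illuminate points whose non-opposed coordinates are below `1 - δ`. -/
lemma flat_illum {B : Set (Fin n → ℝ)} (hB : memU B) {i₀ : Fin n}
    (h1 : allOnes - stdB i₀ ∈ B) {δ : ℝ} (hδ : 0 < δ) (hδ' : δ < 1 / 2) {x : Fin n → ℝ} (hx : x ∈ B)
    (ht : 0 < x i₀) (s : {j : Fin n // j ≠ i₀} → ℤˣ)
    (hs : ∀ j : {j : Fin n // j ≠ i₀}, sg (s j) * x j ≤ 0 ∨ |x j| < 1 - δ) :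
    Illuminates B (dirT i₀ δ (-1) s) x := by
  have ht1 : x i₀ ≤ 1 := (le_abs_self _).trans (coord_le hB hx i₀)
  refine ⟨x i₀, ht, diamond_interior hB h1 ?_ ?_⟩
  · simp [dirT, mkv_self]
  · intro j hj
    have e := mkv_ne i₀ (fun j => δ * sg (s j)) (-1) ⟨j, hj⟩
    simp only at e
    simp only [dirT, Pi.add_apply, Pi.smul_apply, smul_eq_mul, mkv_self, e]
    rw [show x i₀ + x i₀ * -1 = 0 by ring, abs_zero, add_zero, ← mul_assoc]
    have h0 : 0 < x i₀ * δ := by positivity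
    have h2 : x i₀ * δ ≤ δ := by nlinarith
    rcases hs ⟨j, hj⟩ with h | h
    · exact opp_lt (coord_le hB hx j) h h0 (by linarith)
    · exact free_lt h0 (by simp only at h; linarith)

lemma zero_illum {B : Set (Fin n → ℝ)} (hB : memU B) {i₀ : Fin n}
    (h1 : allOnes - stdB i₀ ∈ B) {δ : ℝ} (hδ : 0 < δ) (hδ' : δ < 1 / 2) {x : Fin n → ℝ} (hx : x ∈ B)
    (ht : x i₀ = 0) (s : {j : Fin n // j ≠ i₀} → ℤˣ)
    (sp : ({j : Fin n // j ≠ i₀} → ℤˣ) → {j : Fin n // j ≠ i₀})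
    (hs : ∀ j : {j : Fin n // j ≠ i₀}, sg (s j) * x j ≤ 0) :
    Illuminates B (dirV i₀ δ sp s) x := by
  refine ⟨1 / 2, by norm_num, diamond_interior hB h1 ?_ ?_⟩
  · simp [dirV, mkv_self, ht]
  · intro j hj
    have e := mkv_ne i₀ (fun j => (if sp s = j then δ / 2 else 1) * sg (s j)) 0 ⟨j, hj⟩
    simp only at e
    simp only [dirV, Pi.add_apply, Pi.smul_apply, smul_eq_mul, mkv_self, e, ht]
    rw [mul_zero, add_zero, abs_zero, add_zero, ← mul_assoc]
    apply opp_lt (coord_le hB hx j) (hs ⟨j, hj⟩)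
    · split_ifs <;> linarith
    · split_ifs <;> linarith

/-- Common part of the two remaining cases. -/
lemma combo_illum {B : Set (Fin n → ℝ)} (hB : memU B) {i₀ : Fin n}
    {x q d : Fin n → ℝ} (hx : x ∈ B) (hq : q ∈ interior B) (r l : ℝ) (hr : 0 < r) (hl : 0 < l)
    (hl1 : l ≤ 1) (h0 : |x i₀ + r * d i₀| ≤ |(1 - l) * x i₀ + l * q i₀|)
    (h : ∀ j, j ≠ i₀ → |x j + r * d j| ≤ |(1 - l) * x j + l * q j|) : Illuminates B d x := by
  refine ⟨r, hr, ?_⟩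
  have := hB.1.1.combo_self_interior_mem_interior hx hq (a := 1 - l) (b := l)
    (by linarith) hl (by ring)
  apply box_mono hB.1.1.interior (uncond_interior hB.2.1) this
  intro j
  simp only [Pi.add_apply, Pi.smul_apply, smul_eq_mul]
  by_cases hj : j = i₀
  · subst hj; exact h0
  · exact h j hj

lemma full_illum {B : Set (Fin n → ℝ)} (hB : memU B) {i₀ : Fin n}
    (h1 : allOnes - stdB i₀ ∈ B) {δ : ℝ} (hδ : 0 < δ) (hδ' : δ < 1 / 2) {x : Fin n → ℝ} (hx : x ∈ B)
    (ht : 0 < x i₀) (ht' : x i₀ ≤ 1 - δ) (s : {j : Fin n // j ≠ i₀} → ℤˣ)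
    (sp : ({j : Fin n // j ≠ i₀} → ℤˣ) → {j : Fin n // j ≠ i₀}) (ρ : ℝ) (hρ : 0 < ρ)
    (hs : ∀ j : {j : Fin n // j ≠ i₀}, sg (s j) * x j ≤ 0) (hne : ∀ j, j ≠ i₀ → ρ ≤ |x j|) :
    Illuminates B (dirV i₀ δ sp s) x := by
  let r := min ρ 1
  have hr : 0 < r := lt_min hρ one_pos
  have hr1 : r ≤ 1 := min_le_right _ _
  have hq : (Pi.single i₀ (1 - δ) : Fin n → ℝ) ∈ interior B := by
    apply diamond_interior hB h1
    · simp; rw [abs_lt]; constructor <;> linarith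
    · intro j hj; simp [hj]; rw [abs_lt]; constructor <;> linarith
  refine combo_illum (i₀ := i₀) hB hx hq r (r * (δ / 2)) hr (by positivity) (by nlinarith) ?_ ?_
  · simp only [dirV, mkv_self, Pi.single_eq_same, mul_zero, add_zero]
    have : 0 ≤ r * (δ / 2) := by positivity
    apply abs_le_abs_of_nonneg ht.le
    nlinarith
  · intro j hj
    have e := mkv_ne i₀ (fun j => (if sp s = j then δ / 2 else 1) * sg (s j)) 0 ⟨j, hj⟩
    simp only at e
    simp only [dirV, e, Pi.single_eq_of_ne hj, mul_zero, add_zero]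
    have hl : 0 ≤ r * (δ / 2) := by positivity
    have hl1 : r * (δ / 2) ≤ 1 := by nlinarith
    rw [abs_mul, abs_of_nonneg (by linarith : 0 ≤ 1 - r * (δ / 2)), ← mul_assoc]
    have hρr : r ≤ |x j| := (min_le_left _ _).trans (hne j hj)
    apply opp_dec (coord_le hB hx j) (hs ⟨j, hj⟩) hl
    · split_ifs <;> nlinarith
    · split_ifs <;> nlinarith

lemma edge_illum {B : Set (Fin n → ℝ)} (hB : memU B) {i₀ : Fin n}
    (h1 : allOnes - stdB i₀ ∈ B) {δ : ℝ} (hδ : 0 < δ) (hδ' : δ < 1 / 2) {x : Fin n → ℝ} (hx : x ∈ B)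
    (ht : 0 < x i₀) (ht' : x i₀ ≤ 1 - δ) (s : {j : Fin n // j ≠ i₀} → ℤˣ)
    (sp : ({j : Fin n // j ≠ i₀} → ℤˣ) → {j : Fin n // j ≠ i₀}) (i : {j : Fin n // j ≠ i₀})
    (hspi : sp s = i) (hxi : x i = 0)
    (hs : ∀ j : {j : Fin n // j ≠ i₀}, j ≠ i → sg (s j) * x j ≤ 0)
    (hne : ∀ j : {j : Fin n // j ≠ i₀}, j ≠ i → 1 - δ ≤ |x j|) :
    Illuminates B (dirV i₀ δ sp s) x := by
  let q : Fin n → ℝ := mkv i₀ (fun j => if j = i then δ / 2 else 0) (1 - δ)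
  have q0 : q i₀ = 1 - δ := mkv_self _ _ _
  have qj : ∀ j : {j : Fin n // j ≠ i₀}, q j = if j = i then δ / 2 else 0 := fun j => mkv_ne _ _ _ _
  have hq : q ∈ interior B := by
    apply diamond_interior hB h1
    · rw [q0, abs_lt]; constructor <;> linarith
    · intro j hj
      have := qj ⟨j, hj⟩
      simp only at this
      rw [q0, this, abs_of_nonneg (by linarith : 0 ≤ 1 - δ)]
      split_ifs
      · rw [abs_of_nonneg (by linarith)]; linarith
      · simp; linarith
  refine combo_illum (i₀ := i₀) hB hx hq (1 / 2) (1 / 2) (by norm_num) (by norm_num) (by norm_num) ?_ ?_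
  · simp only [dirV, mkv_self, mul_zero, add_zero, q0]
    apply abs_le_abs_of_nonneg ht.le
    linarith
  · intro j hj
    have e := mkv_ne i₀ (fun j => (if sp s = j then δ / 2 else 1) * sg (s j)) 0 ⟨j, hj⟩
    have e2 := qj ⟨j, hj⟩
    simp only at e e2
    simp only [dirV, e, e2]
    by_cases hji : (⟨j, hj⟩ : {j : Fin n // j ≠ i₀}) = i
    · have hxj : x j = 0 := by rw [← hxi, ← hji]
      rw [hji, hxj, hspi]
      simp only [if_true, zero_add, mul_zero]
      rcases sg_or (s i) with h | h <;> rw [h] <;> simp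
    · have hji' : sp s ≠ ⟨j, hj⟩ := by rw [hspi]; exact Ne.symm hji
      rw [if_neg hji, if_neg hji', one_mul, mul_zero, add_zero, abs_mul,
        abs_of_nonneg (by norm_num : (0 : ℝ) ≤ 1 - 1 / 2)]
      have := hne _ hji
      simp only at this
      exact opp_dec (coord_le hB hx j) (hs _ hji) (by norm_num) le_rfl (by linarith)

end Geo

/-- If `B ∈ 𝒰^n`, `n ≥ 4`, contains `𝟙 - e_{i₀}` for exactly one
index `i₀`, then `B` is illuminated by a symmetric set of at most `2^n - 4`
nonzero directions; in particular `𝕀(B) ≤ 2^n - 4`. -/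
theorem stmt13 (n : ℕ) (hn : 4 ≤ n) (B : Set (Fin n → ℝ)) (hB : memU B)
    (huniq : ∃! i₀ : Fin n, allOnes - stdB i₀ ∈ B) :
    ∃ D : Finset (Fin n → ℝ), (∀ d ∈ D, d ≠ 0) ∧ (∀ d ∈ D, -d ∈ D) ∧
      D.card ≤ 2 ^ n - 4 ∧ IlluminatesSet B ↑D ∧
      illumNumber B ≤ 2 ^ n - 4 := by
  classical
  obtain ⟨i₀, h1, huniq⟩ := huniq
  simp only at h1 huniq
  have hnot : ∀ i, i ≠ i₀ → allOnes - stdB i ∉ B := fun i hi h => hi (huniq i h)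
  obtain ⟨δ, hδ, hδ', hδB⟩ := exists_delta hB hnot
  have hcard : Fintype.card {j : Fin n // j ≠ i₀} = n - 1 := by
    simp [Fintype.card_subtype_compl]
  obtain ⟨T, sp, hTc, hTn, hspn, hface, hedge⟩ :=
    comb (ι := {j : Fin n // j ≠ i₀}) (by rw [hcard]; omega)
  let D : Finset (Fin n → ℝ) := Finset.univ.image (dirV i₀ δ sp) ∪
    (T.image (dirT i₀ δ (-1)) ∪ T.image (dirT i₀ δ 1))
  have hDV : ∀ s, dirV i₀ δ sp s ∈ D := fun s =>
    Finset.mem_union_left _ (Finset.mem_image_of_mem _ (Finset.mem_univ _))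
  have hDT : ∀ s ∈ T, dirT i₀ δ (-1) s ∈ D := fun s hs =>
    Finset.mem_union_right _ (Finset.mem_union_left _ (Finset.mem_image_of_mem _ hs))
  have hDT' : ∀ s ∈ T, dirT i₀ δ 1 s ∈ D := fun s hs =>
    Finset.mem_union_right _ (Finset.mem_union_right _ (Finset.mem_image_of_mem _ hs))
  have hDcases : ∀ d ∈ D, (∃ s, dirV i₀ δ sp s = d) ∨ (∃ s ∈ T, dirT i₀ δ (-1) s = d) ∨
      (∃ s ∈ T, dirT i₀ δ 1 s = d) := by
    intro d hd
    simpa only [D, Finset.mem_union, Finset.mem_image, Finset.mem_univ, true_and] using hd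
  have hDne : ∀ d ∈ D, d ≠ 0 := by
    intro d hd h0
    rcases hDcases d hd with ⟨s, rfl⟩ | ⟨s, _, rfl⟩ | ⟨s, _, rfl⟩
    · have h := congrFun h0 (sp s)
      rw [dirV, mkv_ne] at h
      simp only [if_true, Pi.zero_apply] at h
      rcases sg_or (s (sp s)) with e | e <;> rw [e] at h <;> linarith
    · have h := congrFun h0 i₀
      rw [dirT, mkv_self] at h
      simp at h
    · have h := congrFun h0 i₀
      rw [dirT, mkv_self] at h
      simp at h
  have hDneg : ∀ d ∈ D, -d ∈ D := by
    intro d hd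
    rcases hDcases d hd with ⟨s, rfl⟩ | ⟨s, hs, rfl⟩ | ⟨s, hs, rfl⟩
    · rw [dirV_neg i₀ δ sp hspn]; exact hDV _
    · rw [dirT_neg, neg_neg]; exact hDT' _ (hTn s hs)
    · rw [dirT_neg]; exact hDT _ (hTn s hs)
  have hDcard : D.card ≤ 2 ^ n - 4 := by
    have c0 : (Finset.univ : Finset ({j : Fin n // j ≠ i₀} → ℤˣ)).card = 2 ^ (n - 1) := by
      rw [Finset.card_univ, Fintype.card_fun, hcard, Fintype.card_units_int]
    have c1 := Finset.card_union_le (Finset.univ.image (dirV i₀ δ sp))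
      (T.image (dirT i₀ δ (-1)) ∪ T.image (dirT i₀ δ 1))
    have c2 := Finset.card_union_le (T.image (dirT i₀ δ (-1))) (T.image (dirT i₀ δ 1))
    have c3 := Finset.card_image_le (s := Finset.univ) (f := dirV i₀ δ sp)
    have c4 := Finset.card_image_le (s := T) (f := dirT i₀ δ (-1))
    have c5 := Finset.card_image_le (s := T) (f := dirT i₀ δ 1)
    have p1 : 2 ^ n = 2 ^ (n - 1 - 1) * 4 := by
      obtain ⟨k, rfl⟩ : ∃ k, n = k + 2 := ⟨n - 2, by omega⟩
      simp [pow_add]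
    have p2 : 2 ^ (n - 1) = 2 ^ (n - 1 - 1) * 2 := by
      rw [← pow_succ]; congr 1; omega
    rw [hcard] at hTc
    change D.card ≤ _ at c1
    omega
  have hpos : ∀ x ∈ B, 0 ≤ x i₀ → ∃ d ∈ D, Illuminates B d x := by
    intro x hx ht
    let s : {j : Fin n // j ≠ i₀} → ℤˣ := fun j => if 0 < x j then -1 else 1
    have hs : ∀ j : {j : Fin n // j ≠ i₀}, sg (s j) * x j ≤ 0 := by
      intro j
      by_cases h : 0 < x j
      · simp [s, h, sg, h.le]
      · simp only [s, h, if_false, sg, Units.val_one, Int.cast_one, one_mul]; exact not_lt.mp h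
    rcases ht.eq_or_lt with ht | ht
    · exact ⟨_, hDV s, zero_illum hB h1 hδ hδ' hx ht.symm s sp hs⟩
    by_cases htwo : ∃ a b : {j : Fin n // j ≠ i₀}, a ≠ b ∧ |x a| < 1 - δ ∧ |x b| < 1 - δ
    · obtain ⟨a, b, hab, ha, hb⟩ := htwo
      obtain ⟨s', hs', hag⟩ := hface s a b hab
      refine ⟨_, hDT s' hs', flat_illum hB h1 hδ hδ' hx ht s' ?_⟩
      intro j
      by_cases hja : j = a
      · right; rw [hja]; exact ha
      by_cases hjb : j = b
      · right; rw [hjb]; exact hb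
      left; rw [hag j hja hjb]; exact hs j
    · obtain ⟨i, hi⟩ : ∃ i : {j : Fin n // j ≠ i₀}, ∀ j : {j : Fin n // j ≠ i₀}, j ≠ i →
          1 - δ ≤ |x j| := by
        by_cases h : ∃ i : {j : Fin n // j ≠ i₀}, |x i| < 1 - δ
        · obtain ⟨i, hi⟩ := h
          refine ⟨i, fun j hj => ?_⟩
          by_contra! hlt
          exact htwo ⟨j, i, hj, hlt, hi⟩
        · push Not at h
          exact ⟨sp s, fun j _ => h j⟩
      have ht' : x i₀ ≤ 1 - δ := (le_abs_self _).trans (hδB x hx i i.2 (fun j hj hj0 =>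
        hi ⟨j, hj0⟩ (fun h => hj (congrArg Subtype.val h))))
      by_cases hxi : x i = 0
      · rcases hedge s i with ⟨s', hs', hag⟩ | ⟨s', hag, hsp⟩
        · refine ⟨_, hDT s' hs', flat_illum hB h1 hδ hδ' hx ht s' ?_⟩
          intro j
          by_cases hji : j = i
          · right; rw [hji, hxi, abs_zero]; linarith
          left; rw [hag j hji]; exact hs j
        · exact ⟨_, hDV s', edge_illum hB h1 hδ hδ' hx ht ht' s' sp i hsp hxi
            (fun j hj => by rw [hag j hj]; exact hs j) hi⟩
      · refine ⟨_, hDV s, full_illum hB h1 hδ hδ' hx ht ht' s sp (min |x i| (1 - δ))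
          (lt_min (abs_pos.mpr hxi) (by linarith)) hs ?_⟩
        intro j hj
        by_cases hji : (⟨j, hj⟩ : {j : Fin n // j ≠ i₀}) = i
        · rw [← hji]; exact min_le_left _ _
        · exact (min_le_right _ _).trans (hi _ hji)
  have hneg : ∀ p ∈ interior B, -p ∈ interior B := fun p hp =>
    box_mono hB.1.1.interior (uncond_interior hB.2.1) hp (by simp)
  have hill : IlluminatesSet B ↑D := by
    intro x hxf
    have hx : x ∈ B := hB.1.2.1.isClosed.frontier_subset hxf
    rcases le_total 0 (x i₀) with h | h
    · exact hpos x hx h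
    · have hnx : -x ∈ B := box_mono hB.1.1 hB.2.1 hx (by simp)
      obtain ⟨d, hd, ε, hε, hmem⟩ := hpos (-x) hnx (by simpa using h)
      refine ⟨-d, hDneg d hd, ε, hε, ?_⟩
      have := hneg _ hmem
      convert this using 1
      simp [add_comm]
  refine ⟨D, hDne, hDneg, hDcard, hill, ?_⟩
  exact le_trans (Nat.sInf_le ⟨D, rfl, hDne, hill⟩) hDcard
end
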